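/- arXiv:1307.0267 — 2 statements merged into one kernel-verified Lean document; each statement's English description precedes it below -/
import Mathlib

section
/- The map g ↦ g·gᵀ from SU(2) to the set of symmetric elements of SU(2) is surjective, and for g, h ∈ SU(2) one has g·gᵀ = h·hᵀ if and only if there exists O ∈ SU(2) all of whose entries are real (i.e. O is a real rotation matrix in SO(2)) such that h = g·O. In particular the set S̃² of symmetric elements of SU(2) is identified with the coset space SU(2)/SO(2). -/
/-- `SU(2)` as a predicate on `2×2` complex matrices. -/
def IsSU2 (U : Matrix (Fin 2) (Fin 2) ℂ) : Prop :=
  U.conjTranspose * U = 1 ∧ U.det = 1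

theorem IsSU2.mul_conj {U : Matrix (Fin 2) (Fin 2) ℂ} (h : IsSU2 U) :
    U * U.conjTranspose = 1 := mul_eq_one_comm.mp h.1

theorem IsSU2.conj_eq {U : Matrix (Fin 2) (Fin 2) ℂ} (h : IsSU2 U) :
    U.conjTranspose = U.adjugate := by
  calc U.conjTranspose = U.conjTranspose * (U * U.adjugate) := by
        rw [Matrix.mul_adjugate, h.2]; simp
    _ = U.adjugate := by rw [← mul_assoc, h.1, one_mul]

theorem surj_aux (S : Matrix (Fin 2) (Fin 2) ℂ) (hS : IsSU2 S) (hT : S.transpose = S) :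
    ∃ g : Matrix (Fin 2) (Fin 2) ℂ, IsSU2 g ∧ g * g.transpose = S := by
  have hc := hS.conj_eq
  have hdet := hS.2
  have hb : S 1 0 = S 0 1 := congrFun (congrFun hT 0) 1
  have h0 : star (S 0 0) = S 1 1 := by
    have := congrFun (congrFun hc 0) 0
    simpa [Matrix.adjugate_fin_two] using this
  have h1 : star (S 1 0) = - S 0 1 := by
    have := congrFun (congrFun hc 0) 1
    simpa [Matrix.adjugate_fin_two] using this
  rw [Matrix.det_fin_two, hb] at hdet
  rw [hb] at h1
  have h2 : star (S 1 1) = S 0 0 := by rw [← h0, star_star]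
  have htr : S 0 0 + S 1 1 = ((2 * (S 0 0).re : ℝ) : ℂ) := by
    rw [← h0]; exact Complex.add_conj _
  generalize hx : (S 0 0).re = x at htr
  have hSe : S = !![S 0 0, S 0 1; S 0 1, S 1 1] := by
    ext i j; fin_cases i <;> fin_cases j <;> simp [hb]
  have hn : Complex.normSq (S 0 0) + Complex.normSq (S 0 1) = 1 := by
    have e0 := Complex.mul_conj (S 0 0)
    have e1 := Complex.mul_conj (S 0 1)
    have h0' : (starRingEnd ℂ) (S 0 0) = S 1 1 := h0
    have h1' : (starRingEnd ℂ) (S 0 1) = - S 0 1 := h1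
    rw [h0'] at e0
    rw [h1'] at e1
    have : ((Complex.normSq (S 0 0) + Complex.normSq (S 0 1) : ℝ) : ℂ) = 1 := by
      push_cast
      rw [← e0, ← e1]; linear_combination hdet
    exact_mod_cast this
  rw [Complex.normSq_apply, Complex.normSq_apply, hx] at hn
  by_cases hx1 : x = -1
  · have him : (S 0 0).im = 0 := by subst hx1; nlinarith [mul_self_nonneg (S 0 0).im, mul_self_nonneg (S 0 1).im, mul_self_nonneg (S 0 1).re]
    have hbr : (S 0 1).re = 0 := by subst hx1; nlinarith [mul_self_nonneg (S 0 0).im, mul_self_nonneg (S 0 1).im, mul_self_nonneg (S 0 1).re]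
    have hbi : (S 0 1).im = 0 := by subst hx1; nlinarith [mul_self_nonneg (S 0 0).im, mul_self_nonneg (S 0 1).im, mul_self_nonneg (S 0 1).re]
    have ea : S 0 0 = -1 := by apply Complex.ext <;> simp [hx, hx1, him]
    have eb : S 0 1 = 0 := by apply Complex.ext <;> simp [hbr, hbi]
    have ed : S 1 1 = -1 := by rw [← h0, ea]; simp
    refine ⟨!![Complex.I, 0; 0, -Complex.I], ⟨?_, ?_⟩, ?_⟩
    · ext i j; fin_cases i <;> fin_cases j <;> simp [Matrix.mul_apply]
    · simp [Matrix.det_fin_two]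
    · ext i j; fin_cases i <;> fin_cases j <;> simp [Matrix.mul_apply, ea, eb, ed, hb]
  · have hpos : 0 < 2 + 2 * x := by
      have : x * x ≤ 1 := by nlinarith [mul_self_nonneg (S 0 0).im, mul_self_nonneg (S 0 1).im, mul_self_nonneg (S 0 1).re]
      have h3 : -1 ≤ x := by nlinarith
      have h4 := lt_of_le_of_ne h3 (Ne.symm hx1)
      linarith
    obtain ⟨r, hr⟩ : ∃ r : ℝ, r * r * (2 + 2 * x) = 1 := by
      refine ⟨(Real.sqrt (2 + 2 * x))⁻¹, ?_⟩
      rw [← mul_inv, Real.mul_self_sqrt hpos.le, inv_mul_cancel₀ hpos.ne']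
    have hrc : (r : ℂ) * r * (2 + 2 * x) = 1 := by exact_mod_cast hr
    push_cast at htr
    generalize S 0 0 = a at *
    generalize S 0 1 = b at *
    generalize S 1 1 = d at *
    have h0' : (starRingEnd ℂ) a = d := h0
    have h1' : (starRingEnd ℂ) b = - b := h1
    have h2' : (starRingEnd ℂ) d = a := h2
    refine ⟨!![r * (a + 1), r * b; r * b, r * (d + 1)], ⟨?_, ?_⟩, ?_⟩
    · ext i j; fin_cases i <;> fin_cases j <;> simp [Matrix.mul_apply, h0', h1', h2']
      · linear_combination hrc + r * r * (hdet + htr)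
      · ring
      · ring
      · linear_combination hrc + r * r * (hdet + htr)
    · rw [Matrix.det_fin_two]
      simp
      linear_combination hrc + r * r * (hdet + htr)
    · rw [hSe]
      ext i j; fin_cases i <;> fin_cases j <;> simp [Matrix.mul_apply]
      · linear_combination a * hrc + r * r * (a * htr - hdet)
      · linear_combination b * hrc + r * r * (b * htr)
      · linear_combination b * hrc + r * r * (b * htr)
      · linear_combination d * hrc + r * r * (d * htr - hdet)

/-- The map `g ↦ g·gᵀ` from `SU(2)` to the set of symmetric elements of
`SU(2)` is surjective, and `g·gᵀ = h·hᵀ` for `g, h ∈ SU(2)` iff `h = g·O` for some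
`O ∈ SU(2)` with all entries real (i.e. `O ∈ SO(2)`); hence `S̃² = SU(2)/SO(2)`. -/
theorem stmt_4 :
    (∀ S : Matrix (Fin 2) (Fin 2) ℂ, IsSU2 S → S.transpose = S →
      ∃ g : Matrix (Fin 2) (Fin 2) ℂ, IsSU2 g ∧ g * g.transpose = S) ∧
    (∀ g h : Matrix (Fin 2) (Fin 2) ℂ, IsSU2 g → IsSU2 h →
      (g * g.transpose = h * h.transpose ↔
        ∃ O : Matrix (Fin 2) (Fin 2) ℂ, IsSU2 O ∧ (∀ i j, (O i j).im = 0) ∧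
          h = g * O)) := by
  refine ⟨surj_aux, fun g h hg hh => ⟨fun e => ?_, ?_⟩⟩
  · have hO : IsSU2 (g.conjTranspose * h) := by
      refine ⟨?_, ?_⟩
      · rw [Matrix.conjTranspose_mul, Matrix.conjTranspose_conjTranspose, mul_assoc,
          ← mul_assoc g, hg.mul_conj, one_mul, hh.1]
      · rw [Matrix.det_mul, Matrix.det_conjTranspose, hg.2, hh.2]; simp
    refine ⟨g.conjTranspose * h, hO, ?_, ?_⟩
    · have h1 : (g.conjTranspose * h) * (g.conjTranspose * h).transpose = 1 := by
        have h2 : g.transpose * g.conjTranspose.transpose = 1 := by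
          rw [← Matrix.transpose_mul, hg.1, Matrix.transpose_one]
        rw [Matrix.transpose_mul, mul_assoc, ← mul_assoc h, ← e, mul_assoc g, h2, mul_one, hg.1]
      have h3 : (g.conjTranspose * h).conjTranspose = (g.conjTranspose * h).transpose :=
        left_inv_eq_right_inv hO.1 h1
      intro i j
      have h4 := congrFun (congrFun h3 j) i
      rw [Matrix.conjTranspose_apply, Matrix.transpose_apply] at h4
      exact Complex.conj_eq_iff_im.mp h4
    · rw [← mul_assoc, hg.mul_conj, one_mul]
  · rintro ⟨O, hO, hr, rfl⟩
    have h3 : O.transpose = O.conjTranspose := by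
      ext i j
      rw [Matrix.conjTranspose_apply, Matrix.transpose_apply]
      exact (Complex.conj_eq_iff_im.mpr (hr j i)).symm
    rw [Matrix.transpose_mul, mul_assoc, ← mul_assoc O, h3, hO.mul_conj, one_mul]
end

section
/- Fix a nonzero scalar ħ ∈ ℂ. For every symmetric 2×2 complex matrix K, the product on ℂ[u₁, u₂] defined by f ∗_K g := Σ_{m≥0} (1/m!)(iħ/2)^m Σ_{i₁,…,i_m, j₁,…,j_m ∈ {1,2}} (Π_a Λ_{i_a j_a}) (∂_{i₁}⋯∂_{i_m} f)·(∂_{j₁}⋯∂_{j_m} g), where Λ = K + J and J = [[0, −1], [1, 0]], is ℂ-bilinear, associative, has the constant polynomial 1 as a two-sided unit, and satisfies u₁ ∗_K u₂ − u₂ ∗_K u₁ = −iħ. Thus (ℂ[u₁,u₂], ∗_K) is a realization of the Weyl algebra W₂ whose algebraic structure is independent of K. -/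
open MvPolynomial

/-- The partial derivative `∂ᵢ` on `ℂ[u₁,u₂]`, as an endomorphism. -/
noncomputable def pEnd (i : Fin 2) : Module.End ℂ (MvPolynomial (Fin 2) ℂ) :=
  (MvPolynomial.pderiv i).toLinearMap

/-- The composition `∂_{v 0} ∘ ⋯ ∘ ∂_{v (m−1)}` of partial derivatives. -/
noncomputable def derivs {m : ℕ} (v : Fin m → Fin 2) :
    Module.End ℂ (MvPolynomial (Fin 2) ℂ) :=
  (List.ofFn fun a => pEnd (v a)).prod

/-- The `m`-th term `(1/m!)(iħ/2)^m Σ_{i,j} (Π_a Λ_{i_a j_a})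
(∂_{i₁}⋯∂_{i_m} f)·(∂_{j₁}⋯∂_{j_m} g)` of the `K`-ordered star product,
with `Λ = K + J`; here `hb` stands for `ħ` and `Lam` for `Λ`. -/
noncomputable def starTerm (hb : ℂ) (Lam : Matrix (Fin 2) (Fin 2) ℂ) (m : ℕ)
    (f g : MvPolynomial (Fin 2) ℂ) : MvPolynomial (Fin 2) ℂ :=
  ((m.factorial : ℂ)⁻¹ * (Complex.I * hb / 2) ^ m) •
    ∑ i : Fin m → Fin 2, ∑ j : Fin m → Fin 2,
      (∏ a, Lam (i a) (j a)) • (derivs i f * derivs j g)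

/-- The star product `f ∗_K g = Σ_{m ≥ 0} starTerm hb Λ m f g`; the sum is finite on
polynomials, since all terms with `m > totalDegree f` vanish (an `m`-fold derivative
of `f` is then zero), so it is given by the finite partial sum below. -/
noncomputable def starK (hb : ℂ) (Lam : Matrix (Fin 2) (Fin 2) ℂ)
    (f g : MvPolynomial (Fin 2) ℂ) : MvPolynomial (Fin 2) ℂ :=
  ∑ m ∈ Finset.range (f.totalDegree + 1), starTerm hb Lam m f g

/-- The matrix `J = [[0, −1], [1, 0]]`. -/
def matJ : Matrix (Fin 2) (Fin 2) ℂ := !![0, -1; 1, 0]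

namespace StarAux

abbrev A := MvPolynomial (Fin 2) ℂ

/-- The iterated bidifferential operator, defined recursively as a bilinear map. -/
noncomputable def Q (L : Matrix (Fin 2) (Fin 2) ℂ) : ℕ → A →ₗ[ℂ] A →ₗ[ℂ] A
  | 0 => LinearMap.mul ℂ A
  | m + 1 => ∑ i, ∑ j, L i j • (Q L m).compl₁₂ (pEnd i) (pEnd j)

variable (L : Matrix (Fin 2) (Fin 2) ℂ)

lemma Q_zero (f g : A) : Q L 0 f g = f * g := rfl

lemma Q_succ (m : ℕ) (f g : A) :
    Q L (m + 1) f g = ∑ i, ∑ j, L i j • Q L m (pderiv i f) (pderiv j g) := by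
  simp [Q, pEnd, LinearMap.sum_apply]

lemma derivs_snoc {m : ℕ} (v : Fin m → Fin 2) (a : Fin 2) (f : A) :
    derivs (Fin.snoc v a : Fin (m + 1) → Fin 2) f = derivs v (pderiv a f) := by
  unfold derivs
  rw [List.ofFn_succ', List.concat_eq_append, List.prod_append]
  simp [pEnd]

lemma sum_snoc {m : ℕ} (F : (Fin (m + 1) → Fin 2) → A) :
    ∑ v, F v = ∑ a : Fin 2, ∑ v : Fin m → Fin 2, F (Fin.snoc v a) := by
  rw [← Fintype.sum_prod_type' (fun a (v : Fin m → Fin 2) => F (Fin.snoc v a))]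
  exact (Fintype.sum_equiv (Fin.snocEquiv fun _ => Fin 2) _ _ fun _ => rfl).symm

lemma sum_eq_Q (m : ℕ) : ∀ f g : A,
    ∑ i : Fin m → Fin 2, ∑ j : Fin m → Fin 2,
      (∏ a, L (i a) (j a)) • (derivs i f * derivs j g) = Q L m f g := by
  induction m with
  | zero => intro f g; simp [derivs, Q_zero]
  | succ m ih =>
    intro f g
    rw [Q_succ, sum_snoc]
    refine Finset.sum_congr rfl fun a _ => ?_
    simp_rw [sum_snoc (m := m)]
    rw [Finset.sum_comm]
    refine Finset.sum_congr rfl fun b _ => ?_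
    rw [← ih, Finset.smul_sum]
    refine Finset.sum_congr rfl fun v _ => ?_
    rw [Finset.smul_sum]
    refine Finset.sum_congr rfl fun w _ => ?_
    rw [derivs_snoc, derivs_snoc, Fin.prod_univ_castSucc, smul_smul]
    simp [mul_comm]

lemma Q_vanish (m : ℕ) : ∀ f g : A, (∀ s, s.degree ≥ m → coeff s f = 0) → Q L m f g = 0 := by
  induction m with
  | zero =>
    intro f g h
    have : f = 0 := by ext s; simpa using h s (by simp)
    simp [this]
  | succ m ih =>
    intro f g h
    rw [Q_succ]
    refine Finset.sum_eq_zero fun i _ => Finset.sum_eq_zero fun j _ => ?_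
    rw [ih, smul_zero]
    intro s hs
    rw [coeff_pderiv, h, zero_mul]
    simpa using hs

lemma Q_vanish' {m : ℕ} {f : A} (g : A) (h : f.totalDegree < m) : Q L m f g = 0 := by
  refine Q_vanish L m f g fun s hs => ?_
  by_contra hc
  have := le_totalDegree (mem_support_iff.2 hc)
  rw [Finsupp.degree_apply] at hs
  have h2 : (s.sum fun _ e => e) = ∑ i ∈ s.support, s i := rfl
  omega

lemma pd_comm (i j : Fin 2) (f : A) : pderiv i (pderiv j f) = pderiv j (pderiv i f) := by
  ext s
  rcases eq_or_ne i j with rfl | hij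
  · rfl
  · simp only [coeff_pderiv, Finsupp.add_apply, Finsupp.single_apply, hij, hij.symm, if_false]
    rw [add_right_comm]
    push_cast
    ring

lemma Q_deriv (k : Fin 2) (m : ℕ) : ∀ f g : A,
    pderiv k (Q L m f g) = Q L m (pderiv k f) g + Q L m f (pderiv k g) := by
  induction m with
  | zero => intro f g; simp only [Q_zero, pderiv_mul]
  | succ m ih =>
    intro f g
    simp only [Q_succ, map_sum, Derivation.map_smul, ih, smul_add, Finset.sum_add_distrib,
      pd_comm k]

lemma Q_X (k : Fin 2) (m : ℕ) : ∀ f g : A,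
    Q L (m + 1) (X k * f) g = X k * Q L (m + 1) f g
      + ((m : ℂ) + 1) • ∑ l, L k l • Q L m f (pderiv l g) := by
  induction m with
  | zero =>
    intro f g
    fin_cases k <;>
    simp [Q_succ, Q_zero, pderiv_mul, Fin.sum_univ_two, smul_eq_C_mul, Pi.single_apply] <;> ring
  | succ m ih =>
    intro f g
    rw [Q_succ]
    have e : ∀ i j, Q L (m + 1) (pderiv i (X k * f)) (pderiv j g) =
        (if i = k then Q L (m + 1) f (pderiv j g) else 0)
        + (X k * Q L (m + 1) (pderiv i f) (pderiv j g)
      + ((m : ℂ) + 1) • ∑ l, L k l • Q L m (pderiv i f) (pderiv l (pderiv j g))) := by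
      intro i j
      rw [pderiv_mul, map_add, LinearMap.add_apply, ih, pderiv_X, Pi.single_apply]
      congr 1
      by_cases h : k = i <;> simp [h, eq_comm]
    simp only [e]
    have e2 : ∀ l, Q L (m + 1) f (pderiv l g) =
      ∑ i, ∑ j, L i j • Q L m (pderiv i f) (pderiv l (pderiv j g)) := by
      intro l; rw [Q_succ]; simp only [pd_comm l]
    have e3 : ∑ i, ∑ j, L i j • ((m : ℂ) + 1) • ∑ l, L k l •
        Q L m (pderiv i f) (pderiv l (pderiv j g))
        = ((m : ℂ) + 1) • ∑ l, L k l • Q L (m + 1) f (pderiv l g) := by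
      simp only [e2, Fin.sum_univ_two]
      module
    have e4 : ∑ i, ∑ j, L i j • (if i = k then Q L (m + 1) f (pderiv j g) else 0)
        = ∑ l, L k l • Q L (m + 1) f (pderiv l g) := by
      rw [Finset.sum_eq_single k]
      · simp
      · intro b _ hb; simp [hb]
      · simp
    simp only [smul_add, Finset.sum_add_distrib]
    rw [e3, e4, Q_succ L (m + 1) f g]
    simp only [Finset.mul_sum, mul_smul_comm]
    push_cast
    module

variable (hb : ℂ)

/-- Truncated star product, as a bilinear map. -/
noncomputable def S (N : ℕ) : A →ₗ[ℂ] A →ₗ[ℂ] A :=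
  ∑ m ∈ Finset.range N, ((m.factorial : ℂ)⁻¹ * (Complex.I * hb / 2) ^ m) • Q L m

lemma S_apply (N : ℕ) (f g : A) : S L hb N f g =
    ∑ m ∈ Finset.range N, ((m.factorial : ℂ)⁻¹ * (Complex.I * hb / 2) ^ m) • Q L m f g := by
  simp [S, LinearMap.sum_apply]

lemma starK_eq {N : ℕ} {f : A} (g : A) (h : f.totalDegree < N) :
    starK hb L f g = S L hb N f g := by
  rw [S_apply, starK]
  simp only [starTerm, sum_eq_Q]
  refine Finset.sum_subset (by simpa using h) fun m _ hm => ?_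
  rw [Q_vanish', smul_zero]
  simpa using hm

lemma star_add_left (f f' g : A) :
    starK hb L (f + f') g = starK hb L f g + starK hb L f' g := by
  have h := totalDegree_add f f'
  rw [starK_eq L hb (N := max f.totalDegree f'.totalDegree + 1) g (by omega),
    starK_eq L hb (f := f) (N := max f.totalDegree f'.totalDegree + 1) g (by omega),
    starK_eq L hb (f := f') (N := max f.totalDegree f'.totalDegree + 1) g (by omega),
    map_add, LinearMap.add_apply]

lemma star_smul_left (c : ℂ) (f g : A) : starK hb L (c • f) g = c • starK hb L f g := by
  have h := totalDegree_smul_le c f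
  rw [starK_eq L hb (N := f.totalDegree + 1) g (by omega),
    starK_eq L hb (f := f) (N := f.totalDegree + 1) g (by omega),
    map_smul, LinearMap.smul_apply]

/-- The star product as a bilinear map. -/
noncomputable def B : A →ₗ[ℂ] A →ₗ[ℂ] A :=
  LinearMap.mk₂ ℂ (starK hb L) (star_add_left L hb) (star_smul_left L hb)
    (fun f g g' => by
      simp only [starK_eq L hb (f := f) (N := f.totalDegree + 1) _ (by omega), map_add])
    (fun c f g => by
      simp only [starK_eq L hb (f := f) (N := f.totalDegree + 1) _ (by omega), map_smul])

lemma B_apply (f g : A) : B L hb f g = starK hb L f g := rfl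

lemma B_eq {N : ℕ} {f : A} (g : A) (h : f.totalDegree < N) : B L hb f g = S L hb N f g :=
  starK_eq L hb g h

lemma B_one_left (f : A) : B L hb 1 f = f := by
  rw [B_eq L hb (N := 1) f (by simp), S_apply]; simp [Q_zero]

lemma B_one_right (f : A) : B L hb f 1 = f := by
  rw [B_eq L hb (N := f.totalDegree + 1) 1 (by omega), S_apply, Finset.sum_range_succ']
  simp [Q_zero, Q_succ]

lemma B_deriv (k : Fin 2) (f g : A) :
    pderiv k (B L hb f g) = B L hb (pderiv k f) g + B L hb f (pderiv k g) := by
  set N := max f.totalDegree (pderiv k f).totalDegree + 1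
  rw [B_eq L hb (f := f) (N := N) _ (by omega), B_eq L hb (f := f) (N := N) _ (by omega),
    B_eq L hb (f := pderiv k f) (N := N) _ (by omega)]
  simp only [S_apply, map_sum, Derivation.map_smul, Q_deriv, smul_add, Finset.sum_add_distrib]

lemma B_X_mul (k : Fin 2) (f g : A) :
    B L hb (X k * f) g = X k * B L hb f g
      + (Complex.I * hb / 2) • ∑ l, L k l • B L hb f (pderiv l g) := by
  set N := max f.totalDegree (X k * f).totalDegree + 1
  rw [B_eq L hb (f := X k * f) (N := N + 1) _ (by omega),
    B_eq L hb (f := f) (N := N + 1) _ (by omega)]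
  simp only [B_eq L hb (f := f) (N := N) _ (show f.totalDegree < N by omega)]
  simp only [S_apply]
  rw [Finset.sum_range_succ', Finset.sum_range_succ' _ N]
  have e : ∀ m : ℕ, (((m + 1).factorial : ℂ)⁻¹ * (Complex.I * hb / 2) ^ (m + 1)) •
      Q L (m + 1) (X k * f) g
      = X k * ((((m + 1).factorial : ℂ)⁻¹ * (Complex.I * hb / 2) ^ (m + 1)) • Q L (m + 1) f g)
        + (Complex.I * hb / 2) • ∑ l, L k l •
          (((m.factorial : ℂ)⁻¹ * (Complex.I * hb / 2) ^ m) • Q L m f (pderiv l g)) := by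
    intro m
    rw [Q_X, smul_add, mul_smul_comm]
    congr 1
    have h1 : ((m : ℂ) + 1) ≠ 0 := by exact_mod_cast Nat.succ_ne_zero m
    have h2 : (m.factorial : ℂ) ≠ 0 := by exact_mod_cast m.factorial_ne_zero
    have h3 : (((m + 1).factorial : ℂ)⁻¹ * (Complex.I * hb / 2) ^ (m + 1)) * ((m : ℂ) + 1)
      = (Complex.I * hb / 2) * ((m.factorial : ℂ)⁻¹ * (Complex.I * hb / 2) ^ m) := by
      rw [Nat.factorial_succ]; push_cast; field_simp; ring
    rw [smul_smul, h3, mul_smul, Finset.smul_sum]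
    simp only [smul_comm (L k _)]
  simp only [e, Finset.sum_add_distrib, mul_add, Finset.mul_sum]
  have e5 : ∑ l, L k l • ∑ m ∈ Finset.range N,
      (((m.factorial : ℂ)⁻¹ * (Complex.I * hb / 2) ^ m) • Q L m f (pderiv l g))
      = ∑ m ∈ Finset.range N, ∑ l, L k l •
          (((m.factorial : ℂ)⁻¹ * (Complex.I * hb / 2) ^ m) • Q L m f (pderiv l g)) := by
    rw [Finset.sum_comm]; simp only [Finset.smul_sum]
  rw [e5, Finset.smul_sum]
  simp only [Q_zero, mul_smul_comm, mul_assoc]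
  abel

lemma B_X (k : Fin 2) (g : A) :
    B L hb (X k) g = X k * g + (Complex.I * hb / 2) • ∑ l, L k l • pderiv l g := by
  have := B_X_mul L hb k 1 g
  simpa only [mul_one, B_one_left] using this

lemma B_X_assoc (k : Fin 2) (f g : A) :
    B L hb (B L hb (X k) f) g = B L hb (X k) (B L hb f g) := by
  rw [B_X, B_X, map_add, LinearMap.add_apply, B_X_mul]
  simp only [map_smul, map_sum, LinearMap.smul_apply, LinearMap.sum_apply, B_deriv, smul_add,
    Finset.sum_add_distrib]
  abel

/-- The polynomials that associate on the left with everything. -/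
noncomputable def W : Submodule ℂ A where
  carrier := {f | ∀ g h, B L hb (B L hb f g) h = B L hb f (B L hb g h)}
  add_mem' := by
    intro a b ha hb' g h
    simp only [map_add, LinearMap.add_apply, ha g h, hb' g h]
  zero_mem' := by intro g h; simp
  smul_mem' := by
    intro c a ha g h
    simp only [map_smul, LinearMap.smul_apply, ha g h]

lemma W_star (k : Fin 2) {f : A} (hf : f ∈ W L hb) : B L hb (X k) f ∈ W L hb := by
  intro g h
  rw [B_X_assoc, B_X_assoc, B_X_assoc, hf g h]

lemma monomial_mem (d : ℕ) : ∀ (s : Fin 2 →₀ ℕ) (c : ℂ), s.degree ≤ d →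
    monomial s c ∈ W L hb := by
  induction d with
  | zero =>
    intro s c hs
    have : s = 0 := (Finsupp.degree_eq_zero_iff s).1 (by omega)
    subst this
    have h1 : (monomial 0 c : A) = c • 1 := by
      rw [smul_eq_C_mul, mul_one]; rfl
    rw [h1]
    refine Submodule.smul_mem _ _ fun g h => ?_
    simp only [B_one_left]
  | succ d ih =>
    intro s c hs
    by_cases h0 : s = 0
    · exact ih s c (by simp [h0])
    obtain ⟨k, hk⟩ := Finsupp.ne_iff.1 h0
    obtain ⟨t, rfl⟩ : ∃ t, s = Finsupp.single k 1 + t := by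
      refine ⟨s - Finsupp.single k 1, ?_⟩
      rw [add_tsub_cancel_of_le]
      simpa [Nat.one_le_iff_ne_zero] using hk
    have ht : t.degree ≤ d := by
      rw [map_add, Finsupp.degree_single] at hs; omega
    have e : (monomial (Finsupp.single k 1 + t) c : A) = B L hb (X k) (monomial t c)
        - (Complex.I * hb / 2) • ∑ l, L k l • pderiv l (monomial t c) := by
      rw [B_X, add_sub_cancel_right, X, monomial_mul, one_mul]
    rw [e]
    refine Submodule.sub_mem _ (W_star L hb k (ih t c ht)) (Submodule.smul_mem _ _
      (Submodule.sum_mem _ fun l _ => Submodule.smul_mem _ _ ?_))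
    rw [pderiv_monomial]
    exact ih _ _ ((Finsupp.degree_mono tsub_le_self).trans ht)

lemma B_assoc (f g h : A) : B L hb (B L hb f g) h = B L hb f (B L hb g h) := by
  have : f ∈ W L hb := by
    rw [f.as_sum]
    exact Submodule.sum_mem _ fun s _ => monomial_mem L hb _ s _ le_rfl
  exact this g h

end StarAux

/-- For a nonzero `ħ` and every symmetric `2×2` complex matrix `K`, the
product `∗_K` on `ℂ[u₁,u₂]` (with `Λ = K + J`) is `ℂ`-bilinear, associative, has `1`
as two-sided unit, and satisfies `u₁ ∗_K u₂ − u₂ ∗_K u₁ = −iħ`; thus `(ℂ[u₁,u₂], ∗_K)`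
realizes the Weyl algebra `W₂`, independently of `K`. -/
theorem stmt_18 (hb : ℂ) (hhb : hb ≠ 0) (K : Matrix (Fin 2) (Fin 2) ℂ)
    (hK : K.IsSymm) :
    (∀ f f' g : MvPolynomial (Fin 2) ℂ,
      starK hb (K + matJ) (f + f') g
        = starK hb (K + matJ) f g + starK hb (K + matJ) f' g) ∧
    (∀ f g g' : MvPolynomial (Fin 2) ℂ,
      starK hb (K + matJ) f (g + g')
        = starK hb (K + matJ) f g + starK hb (K + matJ) f g') ∧
    (∀ (c : ℂ) (f g : MvPolynomial (Fin 2) ℂ),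
      starK hb (K + matJ) (c • f) g = c • starK hb (K + matJ) f g) ∧
    (∀ (c : ℂ) (f g : MvPolynomial (Fin 2) ℂ),
      starK hb (K + matJ) f (c • g) = c • starK hb (K + matJ) f g) ∧
    (∀ f g h : MvPolynomial (Fin 2) ℂ,
      starK hb (K + matJ) (starK hb (K + matJ) f g) h
        = starK hb (K + matJ) f (starK hb (K + matJ) g h)) ∧
    (∀ f : MvPolynomial (Fin 2) ℂ, starK hb (K + matJ) 1 f = f) ∧
    (∀ f : MvPolynomial (Fin 2) ℂ, starK hb (K + matJ) f 1 = f) ∧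
    starK hb (K + matJ) (X 0) (X 1) - starK hb (K + matJ) (X 1) (X 0)
      = C (-(Complex.I * hb)) := by
  refine ⟨StarAux.star_add_left _ hb, fun f g g' => map_add (StarAux.B _ hb f) g g',
    StarAux.star_smul_left _ hb, fun c f g => map_smul (StarAux.B _ hb f) c g,
    StarAux.B_assoc _ hb, StarAux.B_one_left _ hb, StarAux.B_one_right _ hb, ?_⟩
  have h01 := hK.apply 0 1
  rw [← StarAux.B_apply, ← StarAux.B_apply, StarAux.B_X, StarAux.B_X]
  simp [Fin.sum_univ_two, matJ, smul_eq_C_mul, Pi.single_apply, h01]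
  have e : (C Complex.I * C hb : MvPolynomial (Fin 2) ℂ)
      = C (Complex.I * hb / 2) + C (Complex.I * hb / 2) := by
    rw [← C_mul, ← C_add, add_halves]
  rw [e]
  ring
end
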